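/- arXiv:2207.13657 — 4 statements merged into one kernel-verified Lean document; each statement's English description precedes it below -/
import Mathlib

section
/- Let p be a prime and let K be an ultrametric normed field in which ‖p‖ < 1. For every x ∈ K, the sequence x^(p^n) converges to 1 as n → ∞ if and only if ‖x − 1‖ < 1. -/
/-- The strong triangle inequality for a difference. -/
theorem norm_sub_le_max {E : Type*} [SeminormedAddCommGroup E] [IsUltrametricDist E] (x y : E) :
    ‖x - y‖ ≤ max ‖x‖ ‖y‖ := by
  simpa [sub_eq_add_neg] using IsUltrametricDist.norm_add_le_max x (-y)

open IsUltrametricDist in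
/-- The `p ^ n`-th power map on `1 + z` agrees with `z ↦ 1 + z ^ (p ^ n)` up to a term of norm
at most `‖p‖ * ‖z‖`, for `z` in the closed unit ball. -/
theorem norm_one_add_pow_prime_pow_sub_le {p : ℕ} (hp : p.Prime) {K : Type*} [NormedField K]
    [IsUltrametricDist K] {z : K} (hz : ‖z‖ ≤ 1) (n : ℕ) :
    ‖(1 + z) ^ p ^ n - 1 - z ^ p ^ n‖ ≤ ‖(p : K)‖ * ‖z‖ := by
  have h := add_pow_prime_pow_eq hp (1 : K) z n
  rw [show (1 + z) ^ p ^ n - 1 - z ^ p ^ n = (1 + z) ^ p ^ n - (1 + z ^ p ^ n) by ring, h,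
    one_pow, add_sub_cancel_left, mul_one, norm_mul, norm_mul]
  refine mul_le_of_le_one_right (by positivity) ?_
  refine norm_sum_le_of_forall_le_of_nonneg zero_le_one fun k _ ↦ ?_
  rw [one_pow, one_mul, norm_mul, norm_pow]
  exact mul_le_one₀ (pow_le_one₀ (norm_nonneg _) hz) (norm_nonneg _)
    (norm_natCast_le_one K _)

/-- The residue field has no nontrivial `p`-power roots of unity. -/
theorem norm_sub_one_lt_one_of_pow_prime_pow {p : ℕ} (hp : p.Prime) {K : Type*} [NormedField K]
    [IsUltrametricDist K] (hpK : ‖(p : K)‖ < 1) {x : K} {n : ℕ} (h : ‖x ^ p ^ n - 1‖ < 1) :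
    ‖x - 1‖ < 1 := by
  have hq : p ^ n ≠ 0 := pow_ne_zero _ hp.ne_zero
  have hx : ‖x‖ ≤ 1 := by
    rw [← pow_le_one_iff_of_nonneg (norm_nonneg x) hq, ← norm_pow]
    simpa using (IsUltrametricDist.norm_add_le_max (x ^ p ^ n - 1) 1).trans
      (max_le h.le norm_one.le)
  have hz : ‖x - 1‖ ≤ 1 :=
    (norm_sub_le_max x 1).trans (max_le hx norm_one.le)
  have key := norm_one_add_pow_prime_pow_sub_le hp hz n
  rw [add_sub_cancel] at key
  rw [← pow_lt_one_iff_of_nonneg (norm_nonneg _) hq, ← norm_pow]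
  have hlt := (norm_sub_le_max (x ^ p ^ n - 1)
    (x ^ p ^ n - 1 - (x - 1) ^ p ^ n)).trans_lt
    (max_lt h (key.trans_lt ((mul_le_of_le_one_right (norm_nonneg _) hz).trans_lt hpK)))
  rwa [sub_sub_cancel] at hlt

/-- Taking `p`-th powers contracts the open unit ball around `1`. -/
theorem norm_pow_prime_sub_one_le {p : ℕ} (hp : p.Prime) {K : Type*} [NormedField K]
    [IsUltrametricDist K] {x : K} (hx : ‖x - 1‖ ≤ 1) :
    ‖x ^ p - 1‖ ≤ max ‖(p : K)‖ ‖x - 1‖ * ‖x - 1‖ := by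
  have key := norm_one_add_pow_prime_pow_sub_le hp hx 1
  rw [add_sub_cancel, pow_one] at key
  have h := IsUltrametricDist.norm_add_le_max (x ^ p - 1 - (x - 1) ^ p) ((x - 1) ^ p)
  rw [sub_add_cancel, norm_pow] at h
  refine h.trans (max_le (key.trans ?_) ?_)
  · gcongr
    exact le_max_left _ _
  · calc ‖x - 1‖ ^ p ≤ ‖x - 1‖ ^ 2 := pow_le_pow_of_le_one (norm_nonneg _) hx hp.two_le
      _ = ‖x - 1‖ * ‖x - 1‖ := sq _
      _ ≤ _ := by
        gcongr
        exact le_max_right _ _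

/-- In an ultrametric normed field of residue characteristic `p`, the sequence
`x ^ (p ^ n)` converges to `1` iff `‖x - 1‖ < 1`. -/
theorem stmt1 (p : ℕ) (hp : p.Prime) (K : Type*) [NormedField K] [IsUltrametricDist K]
    (hpK : ‖(p : K)‖ < 1) (x : K) :
    Filter.Tendsto (fun n : ℕ => x ^ (p ^ n)) Filter.atTop (nhds 1) ↔ ‖x - 1‖ < 1 := by
  constructor
  · intro h
    obtain ⟨n, hn⟩ := (h.eventually (Metric.ball_mem_nhds 1 one_pos)).exists
    exact norm_sub_one_lt_one_of_pow_prime_pow hp hpK (mem_ball_iff_norm.mp hn)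
  · intro hx
    set c := max ‖(p : K)‖ ‖x - 1‖ with hc
    have hc0 : 0 ≤ c := (norm_nonneg _).trans (le_max_left _ _)
    have hc1 : c < 1 := max_lt hpK hx
    have bound (n : ℕ) : ‖x ^ p ^ n - 1‖ ≤ c ^ (n + 1) := by
      induction n with
      | zero => simp [hc]
      | succ n ih =>
        have hle : ‖x ^ p ^ n - 1‖ ≤ c := ih.trans (pow_le_of_le_one hc0 hc1.le n.succ_ne_zero)
        rw [pow_succ p, pow_mul, pow_succ' c]
        refine (norm_pow_prime_sub_one_le hp (hle.trans hc1.le)).trans ?_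
        exact mul_le_mul (max_le (le_max_left _ _) hle) ih (norm_nonneg _) hc0
    rw [tendsto_iff_norm_sub_tendsto_zero]
    exact squeeze_zero (fun _ ↦ norm_nonneg _) bound
      ((tendsto_pow_atTop_nhds_zero_of_lt_one hc0 hc1).comp (Filter.tendsto_add_atTop_nat 1))
end

section
/- Let p be a prime and let K be a complete, algebraically closed ultrametric normed field in which ‖p‖ < 1. For every nonzero x ∈ K, the sequence x^(n!) converges to 1 as n → ∞ if and only if there exist ζ, u ∈ K with x = ζ·u, where ζ^m = 1 for some positive integer m coprime to p and ‖u − 1‖ < 1; moreover, when such a decomposition exists, the pair (ζ, u) is unique. -/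
open Polynomial in
theorem exists_pow_eq_one_norm_sub_lt {K : Type*} [NormedField K] [IsAlgClosed K]
    {m : ℕ} (hm : 0 < m) {y : K}
    (h : ‖y ^ m - 1‖ < 1) : ∃ ζ : K, ζ ^ m = 1 ∧ ‖y - ζ‖ < 1 := by
  have hmonic : (X ^ m - 1 : K[X]).Monic := by
    simpa using monic_X_pow_sub_C (1 : K) hm.ne'
  have heval := (IsAlgClosed.splits (X ^ m - 1 : K[X])).eval_eq_prod_roots_of_monic
    hmonic y
  by_contra! hcon
  simp only [eval_sub, eval_pow, eval_X, eval_one] at heval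
  rw [heval] at h
  refine absurd h (not_lt.2 ?_)
  have hnorm := map_multiset_prod (normHom : K →*₀ ℝ)
    (((X ^ m - 1 : K[X]).roots).map fun a => y - a)
  change ‖_‖ = _ at hnorm
  rw [hnorm, Multiset.map_map]
  refine Multiset.one_le_prod ?_
  intro r hr
  obtain ⟨ζ, hζ, rfl⟩ := Multiset.mem_map.1 hr
  refine hcon ζ ?_
  have := (mem_roots'.1 hζ).2
  simpa [sub_eq_zero] using this

section

variable {K : Type*} [NormedField K] [IsUltrametricDist K]

theorem norm_eq_one_of_norm_sub_one_lt {v : K} (h : ‖v - 1‖ < 1) : ‖v‖ = 1 := by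
  have := IsUltrametricDist.norm_eq_of_add_norm_lt_max (x := v) (y := -1)
    (by rw [← sub_eq_add_neg]; exact lt_of_lt_of_le h (by simp))
  simpa using this

theorem norm_geom_sum_sub_natCast_le {v : K} (hv : ‖v‖ ≤ 1) (m : ℕ) :
    ‖∑ i ∈ Finset.range m, v ^ i - m‖ ≤ ‖v - 1‖ := by
  have h : ∑ i ∈ Finset.range m, v ^ i - m = ∑ i ∈ Finset.range m, (v ^ i - 1) := by
    simp
  rw [h]
  refine IsUltrametricDist.norm_sum_le_of_forall_le_of_nonneg (norm_nonneg _) fun i _ => ?_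
  rw [← mul_geom_sum, norm_mul]
  refine mul_le_of_le_one_right (norm_nonneg _) ?_
  refine IsUltrametricDist.norm_sum_le_of_forall_le_of_nonneg zero_le_one fun j _ => ?_
  rw [norm_pow]
  exact pow_le_one₀ (norm_nonneg _) hv

theorem norm_pow_sub_one_le {v : K} (hv : ‖v‖ ≤ 1) (m : ℕ) :
    ‖v ^ m - 1‖ ≤ ‖v - 1‖ := by
  rw [← mul_geom_sum, norm_mul]
  refine mul_le_of_le_one_right (norm_nonneg _) ?_
  refine IsUltrametricDist.norm_sum_le_of_forall_le_of_nonneg zero_le_one fun j _ => ?_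
  rw [norm_pow]
  exact pow_le_one₀ (norm_nonneg _) hv

theorem norm_pow_sub_one_le_mul_max {v : K} (hv : ‖v‖ ≤ 1) (m : ℕ) :
    ‖v ^ m - 1‖ ≤ ‖v - 1‖ * max ‖v - 1‖ ‖(m : K)‖ := by
  rw [← mul_geom_sum, norm_mul]
  refine mul_le_mul_of_nonneg_left ?_ (norm_nonneg _)
  calc ‖∑ i ∈ Finset.range m, v ^ i‖
      = ‖(∑ i ∈ Finset.range m, v ^ i - m) + m‖ := by rw [sub_add_cancel]
    _ ≤ max ‖∑ i ∈ Finset.range m, v ^ i - m‖ ‖(m : K)‖ :=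
        IsUltrametricDist.norm_add_le_max _ _
    _ ≤ _ := max_le_max_right _ (norm_geom_sum_sub_natCast_le hv m)

theorem norm_pow_pow_sub_one_le {m : ℕ} {u : K} (hu : ‖u - 1‖ < 1) (k : ℕ) :
    ‖u ^ m ^ k - 1‖ ≤ max ‖u - 1‖ ‖(m : K)‖ ^ k := by
  have hu1 := norm_eq_one_of_norm_sub_one_lt hu
  induction k with
  | zero => simpa using hu.le
  | succ k ih =>
    have hk : ‖u ^ m ^ k‖ ≤ 1 := by simp [hu1]
    rw [pow_succ, pow_mul, pow_succ]
    refine (norm_pow_sub_one_le_mul_max hk m).trans ?_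
    gcongr
    exact norm_pow_sub_one_le hu1.le _

theorem tendsto_pow_factorial_of_norm_sub_one_lt {m : ℕ} (hm : 0 < m) (hmK : ‖(m : K)‖ < 1)
    {u : K} (hu : ‖u - 1‖ < 1) :
    Filter.Tendsto (fun n : ℕ => u ^ n.factorial) Filter.atTop (nhds 1) := by
  have hu1 := norm_eq_one_of_norm_sub_one_lt hu
  rw [Metric.tendsto_atTop]
  intro ε hε
  obtain ⟨k, hk⟩ := exists_pow_lt_of_lt_one hε (max_lt hu hmK)
  refine ⟨m ^ k, fun n hn => ?_⟩
  obtain ⟨t, ht⟩ := Nat.dvd_factorial (pow_pos hm k) hn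
  rw [dist_eq_norm, ht, pow_mul]
  have hk1 : ‖u ^ m ^ k‖ ≤ 1 := by simp [hu1]
  exact ((norm_pow_sub_one_le hk1 t).trans (norm_pow_pow_sub_one_le hu k)).trans_lt hk

theorem norm_sub_one_lt_of_norm_pow_prime_pow_sub_one_lt {p : ℕ} (hp : p.Prime)
    (hpK : ‖(p : K)‖ < 1) {v : K} (k : ℕ) (h : ‖v ^ p ^ k - 1‖ < 1) : ‖v - 1‖ < 1 := by
  have hpk : p ^ k ≠ 0 := pow_ne_zero _ hp.ne_zero
  have hv : ‖v‖ = 1 := by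
    have := norm_eq_one_of_norm_sub_one_lt h
    rwa [norm_pow, pow_eq_one_iff_of_nonneg (norm_nonneg _) hpk] at this
  have hw : ‖v - 1‖ ≤ 1 := by
    simpa [hv, sub_eq_add_neg] using IsUltrametricDist.norm_add_le_max v (-1)
  have key := add_pow_prime_pow_eq hp (v - 1) 1 k
  rw [sub_add_cancel, one_pow] at key
  set S := ∑ j ∈ Finset.Ioo 0 (p ^ k),
    (v - 1) ^ (j - 1) * 1 ^ (p ^ k - j - 1) * (((p ^ k).choose j / p : ℕ) : K)
  have hSn : ‖S‖ ≤ 1 := by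
    refine IsUltrametricDist.norm_sum_le_of_forall_le_of_nonneg zero_le_one fun j _ => ?_
    rw [one_pow, mul_one, norm_mul, norm_pow]
    exact mul_le_one₀ (pow_le_one₀ (norm_nonneg _) hw) (norm_nonneg _)
      (IsUltrametricDist.norm_natCast_le_one K _)
  have hpS : ‖-((p : K) * ((v - 1) * S))‖ < 1 := by
    rw [norm_neg, norm_mul, norm_mul]
    exact (mul_le_of_le_one_right (norm_nonneg _)
      (mul_le_one₀ hw (norm_nonneg _) hSn)).trans_lt hpK
  have heq : (v - 1) ^ p ^ k = (v ^ p ^ k - 1) + -((p : K) * ((v - 1) * S)) := by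
    rw [key]; ring
  have hlt : ‖(v - 1) ^ p ^ k‖ < 1 := by
    rw [heq]
    exact (IsUltrametricDist.norm_add_le_max _ _).trans_lt (max_lt h hpS)
  rw [norm_pow] at hlt
  exact (pow_lt_one_iff_of_nonneg (norm_nonneg _) hpk).1 hlt

theorem eq_one_of_pow_eq_one_of_coprime {p m : ℕ} (hpK : ‖(p : K)‖ < 1) (hm : m.Coprime p)
    {v : K} (hv : ‖v - 1‖ < 1) (h : v ^ m = 1) : v = 1 := by
  by_contra hne
  have h0 : ∑ i ∈ Finset.range m, v ^ i = 0 := by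
    have := mul_geom_sum v m
    rw [h, sub_self] at this
    exact (mul_eq_zero.1 this).resolve_left (sub_ne_zero.2 hne)
  have hmK : ‖(m : K)‖ < 1 := by
    have := norm_geom_sum_sub_natCast_le (norm_eq_one_of_norm_sub_one_lt hv).le m
    rw [h0, zero_sub, norm_neg] at this
    exact this.trans_lt hv
  obtain ⟨a, b, hab⟩ := Nat.isCoprime_iff_coprime.2 hm
  have hab' : (a : K) * m + b * p = 1 := by exact_mod_cast congrArg (Int.cast : ℤ → K) hab
  have hlt : ∀ (c : ℤ) {y : K}, ‖y‖ < 1 → ‖(c : K) * y‖ < 1 := fun c y hy => by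
    rw [norm_mul]
    exact (mul_le_of_le_one_left (norm_nonneg _)
      (IsUltrametricDist.norm_intCast_le_one K c)).trans_lt hy
  have := (IsUltrametricDist.norm_add_le_max _ _).trans_lt (max_lt (hlt a hmK) (hlt b hpK))
  rw [hab', norm_one] at this
  exact lt_irrefl _ this

theorem exists_root_of_unity_mul_of_norm_pow_sub_one_lt [IsAlgClosed K] {p : ℕ} (hp : p.Prime)
    (hpK : ‖(p : K)‖ < 1) {x : K} {N : ℕ} (hN : N ≠ 0) (h : ‖x ^ N - 1‖ < 1) :
    ∃ ζ u : K, x = ζ * u ∧ (∃ m : ℕ, 0 < m ∧ m.Coprime p ∧ ζ ^ m = 1) ∧ ‖u - 1‖ < 1 := by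
  obtain ⟨k, m, hpm, rfl⟩ := Nat.exists_eq_pow_mul_and_not_dvd hN p hp.ne_one
  have hm : 0 < m := Nat.pos_of_ne_zero fun h0 => hpm (h0 ▸ dvd_zero p)
  have hcop : m.Coprime p := ((Nat.Prime.coprime_iff_not_dvd hp).2 hpm).symm
  rw [pow_mul] at h
  obtain ⟨η, hη, hyη⟩ := exists_pow_eq_one_norm_sub_lt hm h
  obtain ⟨ζ, hζ, rfl⟩ : ∃ ζ : K, ζ ^ m = 1 ∧ ζ ^ p ^ k = η := by
    obtain ⟨a, ha⟩ := exists_pow_eq_self_of_coprime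
      (((Nat.Coprime.pow_right k hcop).coprime_dvd_left (orderOf_dvd_of_pow_eq_one hη)).symm)
    exact ⟨η ^ a, by rw [← pow_mul, mul_comm, pow_mul, hη, one_pow],
      by rw [← pow_mul, mul_comm, pow_mul, ha]⟩
  have hζ1 : ‖ζ‖ = 1 := (pow_eq_one_iff_of_nonneg (norm_nonneg _) hm.ne').1
    (by rw [← norm_pow, hζ, norm_one])
  have hζ0 : ζ ≠ 0 := norm_ne_zero_iff.1 (by simp [hζ1])
  refine ⟨ζ, x / ζ, (mul_div_cancel₀ x hζ0).symm, ⟨m, hm, hcop, hζ⟩,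
    norm_sub_one_lt_of_norm_pow_prime_pow_sub_one_lt hp hpK k ?_⟩
  rwa [div_pow, div_sub_one (pow_ne_zero _ hζ0), norm_div, norm_pow, hζ1, one_pow, div_one]

end


/-- In a complete algebraically closed ultrametric normed field of residue characteristic `p`,
a nonzero `x` satisfies `x ^ n.factorial → 1` iff `x = ζ * u` with `ζ` a root of unity of order
coprime to `p` and `‖u - 1‖ < 1`; moreover such a decomposition is unique. -/
theorem stmt2 (p : ℕ) (hp : p.Prime) (K : Type*) [NormedField K] [IsUltrametricDist K]
    [CompleteSpace K] [IsAlgClosed K] (hpK : ‖(p : K)‖ < 1) (x : K) (hx : x ≠ 0) :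
    (Filter.Tendsto (fun n : ℕ => x ^ n.factorial) Filter.atTop (nhds 1) ↔
      ∃ ζ u : K, x = ζ * u ∧ (∃ m : ℕ, 0 < m ∧ m.Coprime p ∧ ζ ^ m = 1) ∧ ‖u - 1‖ < 1) ∧
    (∀ ζ u ζ' u' : K,
      x = ζ * u → (∃ m : ℕ, 0 < m ∧ m.Coprime p ∧ ζ ^ m = 1) → ‖u - 1‖ < 1 →
      x = ζ' * u' → (∃ m : ℕ, 0 < m ∧ m.Coprime p ∧ ζ' ^ m = 1) → ‖u' - 1‖ < 1 →
      ζ = ζ' ∧ u = u') := by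
  refine ⟨⟨fun h => ?_, ?_⟩, ?_⟩
  · obtain ⟨n, hn⟩ := (h.eventually (Metric.ball_mem_nhds 1 one_pos)).exists
    rw [dist_eq_norm] at hn
    exact exists_root_of_unity_mul_of_norm_pow_sub_one_lt hp hpK n.factorial_ne_zero hn
  · rintro ⟨ζ, u, rfl, ⟨m, hm, -, hζ⟩, hu⟩
    refine (tendsto_pow_factorial_of_norm_sub_one_lt hp.pos hpK hu).congr' ?_
    filter_upwards [Filter.eventually_ge_atTop m] with n hn
    obtain ⟨t, ht⟩ := Nat.dvd_factorial hm hn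
    rw [mul_pow, show ζ ^ n.factorial = 1 by rw [ht, pow_mul, hζ, one_pow], one_mul]
  · rintro ζ u ζ' u' hxu ⟨m, hm, hmp, hζ⟩ hu hxu' ⟨m', hm', hmp', hζ'⟩ hu'
    have hu1 := norm_eq_one_of_norm_sub_one_lt hu
    have hu0 : u ≠ 0 := norm_ne_zero_iff.1 (by simp [hu1])
    have hζ0 : ζ' ≠ 0 := left_ne_zero_of_mul (hxu' ▸ hx)
    have hprod : ζ * u = ζ' * u' := hxu ▸ hxu'
    have hdiv : ζ / ζ' = u' / u := by
      rw [div_eq_div_iff hζ0 hu0, hprod, mul_comm]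
    have hlt : ‖ζ / ζ' - 1‖ < 1 := by
      rw [hdiv, div_sub_one hu0, norm_div, hu1, div_one, ← sub_sub_sub_cancel_right u' u 1,
        sub_eq_add_neg (u' - 1)]
      exact (IsUltrametricDist.norm_add_le_max _ _).trans_lt (max_lt hu' (by rwa [norm_neg]))
    have hone : ζ / ζ' = 1 := by
      refine eq_one_of_pow_eq_one_of_coprime hpK (hmp.mul_left hmp') hlt ?_
      rw [div_pow, pow_mul, hζ, one_pow, mul_comm, pow_mul, hζ', one_pow, div_one]
    have hζζ' : ζ = ζ' := (div_eq_one_iff_eq hζ0).1 hone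
    exact ⟨hζζ', mul_left_cancel₀ hζ0 (hζζ' ▸ hprod)⟩
end

section
/- Let p be a prime and let K be a complete ultrametric normed field in which ‖p‖ < 1. Then evaluation at 1 is a bijection from the set of continuous maps φ : ℤ_p → K satisfying φ(0) = 1 and φ(a+b) = φ(a)·φ(b) for all a, b ∈ ℤ_p, onto the set {x ∈ K : ‖x − 1‖ < 1}. (Any such φ automatically takes values in the open unit disc around 1, hence in the units of K.) -/
open Filter Topology

section

variable {K : Type*} [NormedField K] [IsUltrametricDist K]

lemma norm_pow_sub_one_le_of_norm_le_one {x : K} (hx : ‖x‖ ≤ 1) (n : ℕ) :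
    ‖x ^ n - 1‖ ≤ ‖x - 1‖ := by
  rw [← geom_sum_mul, norm_mul]
  refine mul_le_of_le_one_left (norm_nonneg _) ?_
  refine IsUltrametricDist.norm_sum_le_of_forall_le_of_nonneg zero_le_one fun i _ => ?_
  rw [norm_pow]
  exact pow_le_one₀ (norm_nonneg _) hx

lemma norm_le_one_of_norm_sub_one_le_one {x : K} (hx : ‖x - 1‖ ≤ 1) : ‖x‖ ≤ 1 := by
  simpa [hx] using IsUltrametricDist.norm_add_le_max (x - 1) 1

lemma norm_pow_natCast_sub_one_le {x : K} {δ : ℝ} (hδ : δ ≤ 1) (hx : ‖x - 1‖ ≤ δ) {p : ℕ}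
    (hp : ‖(p : K)‖ ≤ δ) : ‖x ^ p - 1‖ ≤ δ * ‖x - 1‖ := by
  have hx1 := norm_le_one_of_norm_sub_one_le_one (hx.trans hδ)
  rw [← geom_sum_mul, norm_mul]
  refine mul_le_mul_of_nonneg_right ?_ (norm_nonneg _)
  have key : ∑ i ∈ Finset.range p, x ^ i = ∑ i ∈ Finset.range p, (x ^ i - 1) + (p : K) := by
    simp
  rw [key]
  refine (IsUltrametricDist.norm_add_le_max _ _).trans (max_le ?_ hp)
  exact IsUltrametricDist.norm_sum_le_of_forall_le_of_nonneg ((norm_nonneg _).trans hx)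
    fun i _ => (norm_pow_sub_one_le_of_norm_le_one hx1 i).trans hx

lemma norm_pow_pow_sub_one_le_s7 {x : K} {δ : ℝ} (hδ : δ ≤ 1) (hx : ‖x - 1‖ ≤ δ) {p : ℕ}
    (hp : ‖(p : K)‖ ≤ δ) (k : ℕ) : ‖x ^ p ^ k - 1‖ ≤ δ ^ k := by
  have hx1 := norm_le_one_of_norm_sub_one_le_one (hx.trans hδ)
  have hδ0 : 0 ≤ δ := (norm_nonneg _).trans hx
  induction k with
  | zero => simpa using hx.trans hδ
  | succ k ih =>
    have h := norm_pow_natCast_sub_one_le hδ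
      ((norm_pow_sub_one_le_of_norm_le_one hx1 (p ^ k)).trans hx) hp
    rw [pow_succ p, pow_mul, pow_succ' δ]
    exact h.trans (mul_le_mul_of_nonneg_left ih hδ0)

lemma norm_pow_sub_pow_le_of_modEq {x : K} {δ : ℝ} (hδ : δ ≤ 1) (hx : ‖x - 1‖ ≤ δ) {p : ℕ}
    (hp : ‖(p : K)‖ ≤ δ) {k m n : ℕ} (h : m ≡ n [MOD p ^ k]) : ‖x ^ m - x ^ n‖ ≤ δ ^ k := by
  wlog hmn : n ≤ m generalizing m n
  · rw [norm_sub_rev]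
    exact this h.symm (le_of_not_ge hmn)
  have hx1 := norm_le_one_of_norm_sub_one_le_one (hx.trans hδ)
  obtain ⟨j, hj⟩ := (Nat.modEq_iff_dvd' hmn).1 h.symm
  obtain rfl : m = n + p ^ k * j := by omega
  rw [show x ^ (n + p ^ k * j) - x ^ n = x ^ n * ((x ^ p ^ k) ^ j - 1) by ring, norm_mul]
  have h1 : ∀ i : ℕ, ‖x ^ i‖ ≤ 1 := fun i => by
    rw [norm_pow]
    exact pow_le_one₀ (norm_nonneg _) hx1
  exact (mul_le_of_le_one_left (norm_nonneg _) (h1 n)).trans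
    ((norm_pow_sub_one_le_of_norm_le_one (h1 _) j).trans (norm_pow_pow_sub_one_le_s7 hδ hx hp k))

lemma norm_sub_one_lt_one_of_norm_pow_sub_one_lt_one {p : ℕ} [hpp : Fact p.Prime]
    (hp : ‖(p : K)‖ < 1) {x : K} {n : ℕ} (hx : ‖x ^ p ^ n - 1‖ < 1) : ‖x - 1‖ < 1 := by
  have hN : p ^ n ≠ 0 := pow_ne_zero _ hpp.out.ne_zero
  have hx1 : ‖x‖ ≤ 1 := by
    have := norm_le_one_of_norm_sub_one_le_one hx.le
    rwa [norm_pow, pow_le_one_iff_of_nonneg (norm_nonneg _) hN] at this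
  have hw1 : ‖x - 1‖ ≤ 1 := by
    simpa [hx1, sub_eq_add_neg] using IsUltrametricDist.norm_add_le_max x (-1)
  have key := (Commute.one_right (x - 1)).add_pow_prime_pow_eq hpp.out n
  rw [sub_add_cancel, one_pow] at key
  set S := ∑ k ∈ Finset.Ioo 0 (p ^ n),
    (x - 1) ^ (k - 1) * 1 ^ (p ^ n - k - 1) * ((p ^ n).choose k / p : ℕ)
  have hS1 : ‖(x - 1) * S‖ ≤ 1 := by
    rw [norm_mul]
    refine mul_le_one₀ hw1 (norm_nonneg _) ?_
    refine IsUltrametricDist.norm_sum_le_of_forall_le_of_nonneg zero_le_one fun i _ => ?_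
    rw [one_pow, mul_one, norm_mul, norm_pow]
    exact mul_le_one₀ (pow_le_one₀ (norm_nonneg _) hw1) (norm_nonneg _)
      (IsUltrametricDist.norm_natCast_le_one K _)
  have hw : (x - 1) ^ p ^ n = (x ^ p ^ n - 1) - p * ((x - 1) * S) := by rw [key]; ring
  have h : ‖(x - 1) ^ p ^ n‖ < 1 := by
    rw [hw, sub_eq_add_neg]
    refine (IsUltrametricDist.norm_add_le_max _ _).trans_lt (max_lt hx ?_)
    rw [norm_neg, norm_mul]
    exact (mul_le_of_le_one_right (norm_nonneg _) hS1).trans_lt hp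
  rwa [norm_pow, pow_lt_one_iff_of_nonneg (norm_nonneg _) hN] at h

end

namespace PadicInt

variable {p : ℕ} [hpp : Fact p.Prime]

lemma map_natCast_of_map_add_eq_mul {M : Type*} [Monoid M] {φ : ℤ_[p] → M} (h0 : φ 0 = 1)
    (hadd : ∀ a b, φ (a + b) = φ a * φ b) (n : ℕ) : φ n = φ 1 ^ n := by
  induction n with
  | zero => simpa using h0
  | succ n ih => rw [Nat.cast_succ, hadd, ih, pow_succ]

lemma appr_modEq_of_sub_mem {a b : ℤ_[p]} {k : ℕ}
    (h : a - b ∈ Ideal.span {(p : ℤ_[p]) ^ k}) : a.appr k ≡ b.appr k [MOD p ^ k] := by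
  rw [← ker_toZModPow, RingHom.mem_ker, map_sub, sub_eq_zero] at h
  exact (ZMod.natCast_eq_natCast_iff _ _ _).1 h

lemma appr_natCast_modEq (m k : ℕ) : (m : ℤ_[p]).appr k ≡ m [MOD p ^ k] := by
  have h : toZModPow k (m : ℤ_[p]) = (m : ZMod (p ^ k)) := map_natCast _ m
  exact (ZMod.natCast_eq_natCast_iff _ _ _).1 h

lemma appr_modEq_appr (a : ℤ_[p]) {k n : ℕ} (h : k ≤ n) : a.appr n ≡ a.appr k [MOD p ^ k] :=
  ((Nat.modEq_iff_dvd' (appr_mono a h)).2 (dvd_appr_sub_appr a k n h)).symm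

lemma exists_continuous_forall_natCast_eq_pow {K : Type*} [NormedField K] [IsUltrametricDist K]
    [CompleteSpace K] (hp : ‖(p : K)‖ < 1) {x : K} (hx : ‖x - 1‖ < 1) :
    ∃ φ : ℤ_[p] → K, Continuous φ ∧ ∀ n : ℕ, φ n = x ^ n := by
  obtain ⟨δ, hδ, hδ1⟩ := exists_between (max_lt hx hp)
  have hxδ := ((le_max_left _ _).trans_lt hδ).le
  have hpδ := ((le_max_right _ _).trans_lt hδ).le
  have hδ0 : 0 ≤ δ := (norm_nonneg _).trans hxδ
  have hδlim : Tendsto (fun k => δ ^ k) atTop (𝓝 0) :=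
    tendsto_pow_atTop_nhds_zero_of_lt_one hδ0 hδ1
  have hpow {k m n : ℕ} (h : m ≡ n [MOD p ^ k]) : ‖x ^ m - x ^ n‖ ≤ δ ^ k :=
    norm_pow_sub_pow_le_of_modEq hδ1.le hxδ hpδ h
  have hlim (a : ℤ_[p]) : ∃ y : K, ∀ k, ‖y - x ^ a.appr k‖ ≤ δ ^ k := by
    have hc : CauchySeq fun k => x ^ a.appr k := by
      refine cauchySeq_of_le_geometric δ 1 hδ1 fun k => ?_
      rw [one_mul, dist_eq_norm]
      exact hpow (appr_modEq_appr a k.le_succ).symm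
    obtain ⟨y, hy⟩ := cauchySeq_tendsto_of_complete hc
    refine ⟨y, fun k => le_of_tendsto (hy.sub_const _).norm ?_⟩
    filter_upwards [eventually_ge_atTop k] with n hn
    exact hpow (appr_modEq_appr a hn)
  choose φ hφ using hlim
  refine ⟨φ, ?_, fun n => ?_⟩
  · rw [Metric.continuous_iff]
    intro b ε hε
    obtain ⟨k, hk⟩ := (hδlim.eventually_lt_const hε).exists
    refine ⟨(p : ℝ) ^ (-k : ℤ), zpow_pos (mod_cast hpp.out.pos) _, fun a ha => ?_⟩
    rw [dist_eq_norm] at ha ⊢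
    have hab := hpow (appr_modEq_of_sub_mem ((norm_le_pow_iff_mem_span_pow _ k).1 ha.le))
    refine lt_of_le_of_lt ?_ hk
    have hb := hφ b k
    rw [norm_sub_rev] at hb
    rw [show φ a - φ b = (φ a - x ^ a.appr k) + (x ^ a.appr k - x ^ b.appr k)
      + (x ^ b.appr k - φ b) by ring]
    exact (IsUltrametricDist.norm_add_le_max _ _).trans
      (max_le ((IsUltrametricDist.norm_add_le_max _ _).trans (max_le (hφ a k) hab)) hb)
  · rw [← sub_eq_zero, ← norm_le_zero_iff]
    refine ge_of_tendsto' hδlim fun k => ?_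
    rw [← sub_add_sub_cancel _ (x ^ (n : ℤ_[p]).appr k)]
    exact (IsUltrametricDist.norm_add_le_max _ _).trans
      (max_le (hφ n k) (hpow (appr_natCast_modEq n k)))

end PadicInt

/-- For a complete ultrametric normed field `K` of residue characteristic `p`, evaluation
at `1` is a bijection from continuous multiplicative maps `ℤ_p → K` onto the open unit
disc around `1`. -/
theorem stmt7 (p : ℕ) [Fact p.Prime] (K : Type*) [NormedField K] [IsUltrametricDist K]
    [CompleteSpace K] (hpK : ‖(p : K)‖ < 1) :
    Set.BijOn (fun φ : ℤ_[p] → K => φ 1)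
      {φ : ℤ_[p] → K | Continuous φ ∧ φ 0 = 1 ∧ ∀ a b : ℤ_[p], φ (a + b) = φ a * φ b}
      {x : K | ‖x - 1‖ < 1} := by
  refine ⟨?_, ?_, ?_⟩
  · rintro φ ⟨hφ, h0, hadd⟩
    have hp0 : Tendsto (fun n : ℕ => (p : ℤ_[p]) ^ n) atTop (𝓝 0) :=
      tendsto_pow_atTop_nhds_zero_of_norm_lt_one (PadicInt.norm_lt_one_iff_dvd _ |>.2 dvd_rfl)
    have h1 : Tendsto (fun n : ℕ => φ 1 ^ p ^ n) atTop (𝓝 1) := by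
      rw [← h0]
      refine ((hφ.tendsto 0).comp hp0).congr fun n => ?_
      rw [Function.comp_apply, ← Nat.cast_pow,
        PadicInt.map_natCast_of_map_add_eq_mul h0 hadd]
    obtain ⟨n, hn⟩ := (h1.eventually (Metric.ball_mem_nhds 1 one_pos)).exists
    rw [dist_eq_norm] at hn
    exact norm_sub_one_lt_one_of_norm_pow_sub_one_lt_one hpK hn
  · rintro φ ⟨hφ, hφ0, hφadd⟩ ψ ⟨hψ, hψ0, hψadd⟩ h
    have h : φ 1 = ψ 1 := h
    refine PadicInt.denseRange_natCast.equalizer hφ hψ (funext fun n => ?_)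
    simp only [Function.comp_apply]
    rw [PadicInt.map_natCast_of_map_add_eq_mul hφ0 hφadd,
      PadicInt.map_natCast_of_map_add_eq_mul hψ0 hψadd, h]
  · intro x hx
    obtain ⟨φ, hφ, hnat⟩ := PadicInt.exists_continuous_forall_natCast_eq_pow (p := p) hpK hx
    refine ⟨φ, ⟨hφ, by simpa using hnat 0, fun a b => ?_⟩, by simpa using hnat 1⟩
    refine congr_fun ((PadicInt.denseRange_natCast.prodMap
      PadicInt.denseRange_natCast).equalizer
      (hφ.comp continuous_add) ((hφ.comp continuous_fst).mul (hφ.comp continuous_snd))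
      (funext fun ⟨m, n⟩ => ?_)) (a, b)
    simp [← Nat.cast_add, hnat, pow_add]
end

section
/- Let p be a prime and let K be a complete, algebraically closed ultrametric normed field with ‖p‖ < 1, and assume that for every x ∈ K with ‖x‖ = 1 there exists a positive integer m with ‖x^m − 1‖ < 1 (this holds exactly when the residue field of K is algebraic over 𝔽_p, e.g. for K = ℂ_p). Then for every nonzero x ∈ K, the sequence x^(n!) converges to 1 as n → ∞ if and only if ‖x‖ = 1. -/
theorem IsUltrametricDist.norm_pow_sub_one_le {K : Type*} [NormedField K] [IsUltrametricDist K]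
    {y : K} (hy : ‖y‖ ≤ 1) (n : ℕ) : ‖y ^ n - 1‖ ≤ ‖y - 1‖ := by
  rw [← geom_sum_mul, norm_mul]
  refine mul_le_of_le_one_left (norm_nonneg _) ?_
  refine IsUltrametricDist.norm_sum_le_of_forall_le_of_nonneg zero_le_one fun i _ => ?_
  rw [norm_pow]
  exact pow_le_one₀ (norm_nonneg _) hy

theorem IsUltrametricDist.norm_pow_sub_one_le_max_mul {K : Type*} [NormedField K]
    [IsUltrametricDist K] {y : K} (hy : ‖y‖ ≤ 1) (n : ℕ) :
    ‖y ^ n - 1‖ ≤ max ‖(n : K)‖ ‖y - 1‖ * ‖y - 1‖ := by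
  have key : ∑ i ∈ Finset.range n, y ^ i = n + ∑ i ∈ Finset.range n, (y ^ i - 1) := by simp
  rw [← geom_sum_mul, norm_mul, key]
  gcongr
  refine (norm_add_le_max _ _).trans (max_le_max le_rfl ?_)
  exact norm_sum_le_of_forall_le_of_nonneg (norm_nonneg _) fun i _ => norm_pow_sub_one_le hy i

theorem IsUltrametricDist.norm_pow_pow_sub_one_le {K : Type*} [NormedField K]
    [IsUltrametricDist K] {y : K} (hy : ‖y‖ ≤ 1) (n k : ℕ) :
    ‖y ^ n ^ k - 1‖ ≤ max ‖(n : K)‖ ‖y - 1‖ ^ k * ‖y - 1‖ := by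
  induction k with
  | zero => simp
  | succ k ih =>
    have hyk : ‖y ^ n ^ k‖ ≤ 1 := by
      rw [norm_pow]
      exact pow_le_one₀ (norm_nonneg _) hy
    rw [pow_succ, pow_mul, pow_succ', mul_assoc]
    refine (norm_pow_sub_one_le_max_mul hyk n).trans ?_
    gcongr
    exact norm_pow_sub_one_le hy _

theorem IsUltrametricDist.norm_eq_one_of_norm_sub_one_lt {K : Type*} [NormedField K]
    [IsUltrametricDist K] {y : K} (hy : ‖y - 1‖ < 1) : ‖y‖ = 1 := by
  have h := norm_add_eq_max_of_norm_ne_norm (x := y - 1) (y := 1) (by simpa using hy.ne)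
  rwa [sub_add_cancel, norm_one, max_eq_right hy.le] at h


/-- Over a complete algebraically closed ultrametric normed field of residue
characteristic `p` whose residue field is algebraic over `𝔽_p` (e.g. `ℂ_p`), a nonzero
`x` satisfies `x ^ n ! → 1` iff `‖x‖ = 1`. -/
theorem stmt9 (p : ℕ) (hp : p.Prime) (K : Type*) [NormedField K] [IsUltrametricDist K]
    [CompleteSpace K] [IsAlgClosed K] (hpK : ‖(p : K)‖ < 1)
    (hres : ∀ x : K, ‖x‖ = 1 → ∃ m : ℕ, 0 < m ∧ ‖x ^ m - 1‖ < 1)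
    (x : K) (hx : x ≠ 0) :
    Filter.Tendsto (fun n : ℕ => x ^ n.factorial) Filter.atTop (nhds 1) ↔ ‖x‖ = 1 := by
  constructor
  · intro h
    obtain ⟨N, hN⟩ := Metric.tendsto_atTop.1 h 1 one_pos
    have hN := hN N le_rfl
    rw [dist_eq_norm] at hN
    have h1 := IsUltrametricDist.norm_eq_one_of_norm_sub_one_lt hN
    rw [norm_pow] at h1
    exact (pow_eq_one_iff_of_nonneg (norm_nonneg x) N.factorial_ne_zero).1 h1
  · intro h
    obtain ⟨m, hm, hxm⟩ := hres x h
    have hpow (n : ℕ) : ‖x ^ n‖ ≤ 1 := by rw [norm_pow, h, one_pow]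
    refine Metric.tendsto_atTop.2 fun ε hε => ?_
    obtain ⟨k, hk⟩ := exists_pow_lt_of_lt_one hε (max_lt hpK hxm)
    refine ⟨m * p ^ k, fun n hn => ?_⟩
    obtain ⟨d, hd⟩ := Nat.dvd_factorial (Nat.mul_pos hm (pow_pos hp.pos k)) hn
    rw [dist_eq_norm, hd, pow_mul]
    calc ‖(x ^ (m * p ^ k)) ^ d - 1‖ ≤ ‖(x ^ m) ^ p ^ k - 1‖ := by
          rw [← pow_mul x m]
          exact IsUltrametricDist.norm_pow_sub_one_le (hpow _) d
      _ ≤ max ‖(p : K)‖ ‖x ^ m - 1‖ ^ k * ‖x ^ m - 1‖ :=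
          IsUltrametricDist.norm_pow_pow_sub_one_le (hpow m) p k
      _ ≤ max ‖(p : K)‖ ‖x ^ m - 1‖ ^ k :=
          mul_le_of_le_one_right (by positivity) hxm.le
      _ < ε := hk
end
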